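/- For every real p ≥ 6 and every σ with 1 ≤ σ ≤ 1 + 1/(5p), one has h(p,σ) < 0, where h(p,σ) = ∂g(p,σ)/∂σ and g(p,σ) = -(1 + σ^p)^{1 + 1/p}(B(p,σ)^{p-1} - τ(p,σ)^{p-1} A(p,σ)^{p-1}) ∂Δ(p,σ)/∂σ. -/

import Mathlib

/-- `σ_p = (2^p - 1)^{1/p}`. -/
noncomputable def sigmaP (p : ℝ) : ℝ := (2 ^ p - 1) ^ (1 / p)

/-- `A = A(p,σ,τ) = (1 + τ^p)^{-1/p} - (1 + σ^p)^{-1/p}`. -/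
noncomputable def Acoef (p σ τ : ℝ) : ℝ := (1 + τ ^ p) ^ (-1 / p) - (1 + σ ^ p) ^ (-1 / p)

/-- `B = B(p,σ,τ) = σ (1 + σ^p)^{-1/p} + τ (1 + τ^p)^{-1/p}`. -/
noncomputable def Bcoef (p σ τ : ℝ) : ℝ :=
  σ * (1 + σ ^ p) ^ (-1 / p) + τ * (1 + τ ^ p) ^ (-1 / p)

/-- Given the branch `T : σ ↦ τ(p,σ)`, the Minkowski–Cohn function
`Δ(p,σ) = (τ(p,σ) + σ)(1 + τ(p,σ)^p)^{-1/p}(1 + σ^p)^{-1/p}`. -/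
noncomputable def DeltaFun (p : ℝ) (T : ℝ → ℝ) (σ : ℝ) : ℝ :=
  (T σ + σ) * (1 + T σ ^ p) ^ (-1 / p) * (1 + σ ^ p) ^ (-1 / p)

/-- Given the branch `T : σ ↦ τ(p,σ)`, the function
`g(p,σ) = -(1 + σ^p)^{1 + 1/p} (B^{p-1} - τ^{p-1} A^{p-1}) ∂Δ(p,σ)/∂σ`. -/
noncomputable def gFun (p : ℝ) (T : ℝ → ℝ) (σ : ℝ) : ℝ :=
  -(1 + σ ^ p) ^ (1 + 1 / p) *
    (Bcoef p σ (T σ) ^ (p - 1) - T σ ^ (p - 1) * Acoef p σ (T σ) ^ (p - 1)) *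
    derivWithin (DeltaFun p T) (Set.Icc 1 (sigmaP p)) σ

open Set Filter Topology

/-- The factor `(1 + x^p)^{-1/p}` that scales `(1, x)` to the unit sphere of the `p`-norm. -/
noncomputable def unitScale (p x : ℝ) : ℝ := (1 + x ^ p) ^ (-1 / p)

lemma Acoef_eq (p σ τ : ℝ) : Acoef p σ τ = unitScale p τ - unitScale p σ := rfl

lemma Bcoef_eq (p σ τ : ℝ) :
    Bcoef p σ τ = σ * unitScale p σ + τ * unitScale p τ := rfl

lemma one_add_rpow_pos {p x : ℝ} (hx : 0 ≤ x) : 0 < 1 + x ^ p := by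
  have := Real.rpow_nonneg hx p
  linarith

lemma unitScale_pos {p x : ℝ} (hx : 0 ≤ x) : 0 < unitScale p x :=
  Real.rpow_pos_of_pos (one_add_rpow_pos hx) _

lemma unitScale_le_one {p x : ℝ} (hp : 0 < p) (hx : 0 ≤ x) : unitScale p x ≤ 1 := by
  apply Real.rpow_le_one_of_one_le_of_nonpos
  · linarith [Real.rpow_nonneg hx p]
  · exact div_nonpos_of_nonpos_of_nonneg (by norm_num) hp.le

lemma unitScale_zero {p : ℝ} (hp : 0 < p) : unitScale p 0 = 1 := by
  simp [unitScale, Real.zero_rpow hp.ne']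

lemma unitScale_rpow {p x : ℝ} (hp : 0 < p) (hx : 0 ≤ x) :
    unitScale p x ^ p = (1 + x ^ p)⁻¹ := by
  rw [unitScale, ← Real.rpow_mul (one_add_rpow_pos hx).le, div_mul_cancel₀ _ hp.ne',
    Real.rpow_neg_one]

lemma unitScale_rpow_add_one {p x : ℝ} (hp : 0 < p) (hx : 0 ≤ x) :
    unitScale p x ^ (p + 1) * (1 + x ^ p) = unitScale p x := by
  rw [Real.rpow_add (unitScale_pos hx), Real.rpow_one, unitScale_rpow hp hx]
  field_simp [(one_add_rpow_pos (p := p) hx).ne']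

lemma unitScale_antitone {p x y : ℝ} (hp : 0 < p) (hx : 0 ≤ x) (hxy : x ≤ y) :
    unitScale p y ≤ unitScale p x := by
  apply Real.rpow_le_rpow_of_nonpos (one_add_rpow_pos hx)
  · linarith [Real.rpow_le_rpow hx hxy hp.le]
  · exact div_nonpos_of_nonpos_of_nonneg (by norm_num) hp.le

lemma rpow_sub_one_mul {p x : ℝ} (hp : 1 < p) (hx : 0 ≤ x) : x ^ (p - 1) * x = x ^ p := by
  rcases hx.eq_or_lt with rfl | h
  · simp [Real.zero_rpow (by linarith : p ≠ 0)]
  · rw [← Real.rpow_add_one h.ne', sub_add_cancel]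

lemma hasStrictDerivAt_unitScale {p x : ℝ} (hp : 1 < p) (hx : 0 ≤ x) :
    HasStrictDerivAt (unitScale p) (-(x ^ (p - 1) * unitScale p x ^ (p + 1))) x := by
  have h1 : HasStrictDerivAt (fun y : ℝ => 1 + y ^ p) (p * x ^ (p - 1)) x :=
    (Real.hasStrictDerivAt_rpow_const (Or.inr hp.le)).const_add 1
  have h2 := (Real.hasStrictDerivAt_rpow_const_of_ne
    (one_add_rpow_pos (p := p) hx).ne' (-1 / p)).comp x h1
  have h3 : unitScale p x ^ (p + 1) = (1 + x ^ p) ^ (-1 / p - 1) := by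
    rw [unitScale, ← Real.rpow_mul (one_add_rpow_pos hx).le]
    congr 1
    have : p ≠ 0 := by linarith
    field_simp
    ring
  rw [h3]
  convert! h2 using 1
  have : p ≠ 0 := by linarith
  field_simp

lemma hasStrictDerivAt_mul_unitScale {p x : ℝ} (hp : 1 < p) (hx : 0 ≤ x) :
    HasStrictDerivAt (fun y => y * unitScale p y) (unitScale p x ^ (p + 1)) x := by
  have h := (hasStrictDerivAt_id x).mul (hasStrictDerivAt_unitScale hp hx)
  convert! h using 1
  have h1 := unitScale_rpow_add_one (by linarith : 0 < p) hx
  have h2 := rpow_sub_one_mul hp hx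
  simp only [id]
  linear_combination h1 + unitScale p x ^ (p + 1) * h2

/-- One-dimensional implicit function theorem with explicit derivative. -/
lemma exists_implicit_hasDerivAt {F : ℝ × ℝ → ℝ} {a b x y : ℝ}
    (h : HasStrictFDerivAt F
      (a • ContinuousLinearMap.fst ℝ ℝ ℝ + b • ContinuousLinearMap.snd ℝ ℝ ℝ) (x, y))
    (hb : b ≠ 0) :
    ∃ φ : ℝ → ℝ, HasDerivAt φ (-a / b) x ∧ φ x = y ∧
      ∀ᶠ z in 𝓝 x, F (z, φ z) = F (x, y) := by
  have hinv : ((a • ContinuousLinearMap.fst ℝ ℝ ℝ + b • ContinuousLinearMap.snd ℝ ℝ ℝ) ∘L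
      ContinuousLinearMap.inr ℝ ℝ ℝ).IsInvertible :=
    ⟨ContinuousLinearEquiv.unitsEquivAut ℝ (Units.mk0 b hb), by ext; simp⟩
  have hφy : h.implicitFunctionOfProdDomain hinv x = y :=
    (h.eventually_apply_eq_iff_implicitFunctionOfProdDomain hinv).self_of_nhds.mp rfl
  have hφF := h.eventually_apply_implicitFunctionOfProdDomain hinv
  have hφd := (h.hasStrictFDerivAt_implicitFunctionOfProdDomain hinv).hasFDerivAt.hasDerivAt
  refine ⟨_, ?_, hφy, hφF⟩
  set φ := h.implicitFunctionOfProdDomain hinv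
  set d := (-((a • ContinuousLinearMap.fst ℝ ℝ ℝ + b • ContinuousLinearMap.snd ℝ ℝ ℝ) ∘L
      ContinuousLinearMap.inr ℝ ℝ ℝ).inverse ∘L
      ((a • ContinuousLinearMap.fst ℝ ℝ ℝ + b • ContinuousLinearMap.snd ℝ ℝ ℝ) ∘L
      ContinuousLinearMap.inl ℝ ℝ ℝ)) 1
  have hcomp : HasDerivAt (fun z => F (z, φ z)) (a * 1 + b * d) x := by
    have h1 := (hasDerivAt_id x).prodMk hφd
    have h2 := HasFDerivAt.comp_hasDerivAt_of_eq (y := (x, y)) x h.hasFDerivAt h1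
      (by simp only [id]; exact Prod.ext rfl hφy.symm)
    simpa [Function.comp_def] using h2
  have hconst : HasDerivAt (fun z => F (z, φ z)) 0 x :=
    (hasDerivAt_const x (F (x, y))).congr_of_eventuallyEq hφF
  have heq := hcomp.unique hconst
  have : -a / b = d := by
    field_simp
    linarith
  rw [this]
  exact hφd

/-- The left-hand side of the equation `A^p + B^p = 1`. -/
noncomputable def level (p : ℝ) (v : ℝ × ℝ) : ℝ := Acoef p v.1 v.2 ^ p + Bcoef p v.1 v.2 ^ p

lemma hasStrictFDerivAt_level {p σ τ : ℝ} (hp : 1 < p) (hσ : 0 ≤ σ) (hτ : 0 ≤ τ) :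
    HasStrictFDerivAt (level p)
      ((p * unitScale p σ ^ (p + 1) *
          (Bcoef p σ τ ^ (p - 1) + σ ^ (p - 1) * Acoef p σ τ ^ (p - 1))) •
        ContinuousLinearMap.fst ℝ ℝ ℝ +
      (p * unitScale p τ ^ (p + 1) *
          (Bcoef p σ τ ^ (p - 1) - τ ^ (p - 1) * Acoef p σ τ ^ (p - 1))) •
        ContinuousLinearMap.snd ℝ ℝ ℝ) (σ, τ) := by
  have f1 : HasStrictFDerivAt (fun v : ℝ × ℝ => v.1) (ContinuousLinearMap.fst ℝ ℝ ℝ) (σ, τ) :=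
    hasStrictFDerivAt_fst
  have f2 : HasStrictFDerivAt (fun v : ℝ × ℝ => v.2) (ContinuousLinearMap.snd ℝ ℝ ℝ) (σ, τ) :=
    hasStrictFDerivAt_snd
  have s1 := (hasStrictDerivAt_unitScale hp hσ).comp_hasStrictFDerivAt_of_eq (σ, τ) f1 rfl
  have s2 := (hasStrictDerivAt_unitScale hp hτ).comp_hasStrictFDerivAt_of_eq (σ, τ) f2 rfl
  have k1 := (hasStrictDerivAt_mul_unitScale hp hσ).comp_hasStrictFDerivAt_of_eq (σ, τ) f1 rfl
  have k2 := (hasStrictDerivAt_mul_unitScale hp hτ).comp_hasStrictFDerivAt_of_eq (σ, τ) f2 rfl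
  have h := ((s2.sub s1).rpow_const (p := p) (Or.inr hp.le)).add
    ((k1.add k2).rpow_const (p := p) (Or.inr hp.le))
  refine h.congr_fderiv ?_
  ext <;> simp [Acoef_eq, Bcoef_eq] <;> ring

lemma one_le_two_rpow_sub_one {p : ℝ} (hp : 1 ≤ p) : 1 ≤ (2 : ℝ) ^ p - 1 := by
  have := Real.rpow_le_rpow_of_exponent_le (by norm_num : (1 : ℝ) ≤ 2) hp
  rw [Real.rpow_one] at this
  linarith

lemma sigmaP_rpow {p : ℝ} (hp : 1 ≤ p) : sigmaP p ^ p = 2 ^ p - 1 := by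
  have h := one_le_two_rpow_sub_one hp
  rw [sigmaP, ← Real.rpow_mul (by linarith), one_div_mul_cancel (by linarith), Real.rpow_one]

lemma sigmaP_nonneg {p : ℝ} (hp : 1 ≤ p) : 0 ≤ sigmaP p :=
  Real.rpow_nonneg (by linarith [one_le_two_rpow_sub_one hp]) _

lemma unitScale_sigmaP {p : ℝ} (hp : 1 ≤ p) : unitScale p (sigmaP p) = 1 / 2 := by
  have hp0 : p ≠ 0 := by linarith
  rw [unitScale, sigmaP_rpow hp, add_sub_cancel, ← Real.rpow_mul (by norm_num),
    mul_div_cancel₀ _ hp0, Real.rpow_neg_one]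
  norm_num

lemma half_le_unitScale {p σ : ℝ} (hp : 1 ≤ p) (hσ : σ ∈ Icc 1 (sigmaP p)) :
    1 / 2 ≤ unitScale p σ := by
  rw [← unitScale_sigmaP hp]
  exact unitScale_antitone (by linarith) (by linarith [hσ.1]) hσ.2

lemma Acoef_nonneg {p σ τ : ℝ} (hp : 0 < p) (hτ : 0 ≤ τ) (hτσ : τ ≤ σ) : 0 ≤ Acoef p σ τ :=
  sub_nonneg.2 (unitScale_antitone hp hτ hτσ)

lemma Acoef_lt_Bcoef {p σ τ : ℝ} (hp : 1 ≤ p) (hσ : σ ∈ Icc 1 (sigmaP p))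
    (hτ : 0 < τ) : Acoef p σ τ < Bcoef p σ τ := by
  have h1 := half_le_unitScale hp hσ
  have h2 := unitScale_le_one (by linarith : 0 < p) hτ.le
  have h3 := unitScale_pos (p := p) hτ.le
  rw [Acoef_eq, Bcoef_eq]
  nlinarith [mul_pos hτ h3, mul_nonneg (sub_nonneg.2 hσ.1) (sub_nonneg.2 h1), hσ.1]

/-- The factor `B^{p-1} - τ^{p-1} A^{p-1}` of the partial derivative in `τ` is positive. -/
lemma level_factor_pos {p σ τ : ℝ} (hp : 1 < p) (hσ : σ ∈ Icc 1 (sigmaP p))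
    (hτ : 0 < τ) (hτ1 : τ < 1) :
    0 < Bcoef p σ τ ^ (p - 1) - τ ^ (p - 1) * Acoef p σ τ ^ (p - 1) := by
  have hA := Acoef_nonneg (by linarith : 0 < p) hτ.le (hτ1.le.trans hσ.1)
  have h1 := Real.rpow_lt_rpow hA (Acoef_lt_Bcoef hp.le hσ hτ) (by linarith : 0 < p - 1)
  have h2 := Real.rpow_le_one hτ.le hτ1.le (by linarith : 0 ≤ p - 1)
  have h3 := Real.rpow_nonneg hA (p - 1)
  nlinarith

lemma hasDerivAt_level_right {p σ τ : ℝ} (hp : 1 < p) (hσ : 0 ≤ σ) (hτ : 0 ≤ τ) :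
    HasDerivAt (fun y => level p (σ, y)) (p * unitScale p τ ^ (p + 1) *
          (Bcoef p σ τ ^ (p - 1) - τ ^ (p - 1) * Acoef p σ τ ^ (p - 1))) τ := by
  have h := (hasStrictFDerivAt_level hp hσ hτ).hasFDerivAt.comp_hasDerivAt τ
    ((hasDerivAt_const τ σ).prodMk (hasDerivAt_id τ))
  simpa [Function.comp_def] using h

lemma level_strictMonoOn {p σ : ℝ} (hp : 1 < p) (hσ : σ ∈ Icc 1 (sigmaP p)) :
    StrictMonoOn (fun y => level p (σ, y)) (Ico 0 1) := by
  have hσ0 : 0 ≤ σ := by linarith [hσ.1]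
  apply strictMonoOn_of_deriv_pos (convex_Ico 0 1)
  · exact fun y hy => (hasDerivAt_level_right hp hσ0 hy.1).continuousAt.continuousWithinAt
  · intro y hy
    rw [interior_Ico] at hy
    rw [(hasDerivAt_level_right hp hσ0 hy.1.le).deriv]
    exact mul_pos (mul_pos (by linarith) (Real.rpow_pos_of_pos (unitScale_pos hy.1.le) _))
      (level_factor_pos hp hσ hy.1 hy.2)

lemma level_zero_ne_one {p σ : ℝ} (hp : 1 < p) (h1 : 1 ≤ σ) (h2 : σ < sigmaP p) :
    level p (σ, 0) ≠ 1 := by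
  intro h
  have hp0 : 0 < p := by linarith
  have hσ0 : 0 ≤ σ := by linarith
  have hs := unitScale_pos (p := p) hσ0
  have hs1 := unitScale_le_one hp0 hσ0
  have hsp := unitScale_rpow hp0 hσ0
  simp only [level, Acoef_eq, Bcoef_eq, unitScale_zero hp0, zero_mul, add_zero] at h
  rw [Real.mul_rpow hσ0 hs.le] at h
  have h3 : (1 + σ ^ p) * unitScale p σ ^ p = 1 := by
    rw [hsp]; exact mul_inv_cancel₀ (one_add_rpow_pos hσ0).ne'
  have h4 : (1 - unitScale p σ) ^ p = unitScale p σ ^ p := by linarith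
  have h5 : 1 - unitScale p σ = unitScale p σ :=
    Real.rpow_left_injOn hp0.ne' (show 0 ≤ 1 - unitScale p σ by linarith) hs.le h4
  have h6 : unitScale p σ = 1 / 2 := by linarith
  rw [h6, Real.div_rpow (by norm_num) (by norm_num), Real.one_rpow] at h3
  have h7 := Real.rpow_lt_rpow hσ0 h2 hp0
  rw [sigmaP_rpow hp.le] at h7
  have h8 : (0 : ℝ) < 2 ^ p := by positivity
  field_simp at h3
  linarith

/-- A branch of solutions in `[0,1)` of `A^p + B^p = 1` over `[1, σ_p]`. -/
def IsBranch (p : ℝ) (T : ℝ → ℝ) : Prop :=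
  ∀ σ ∈ Icc 1 (sigmaP p), 0 ≤ T σ ∧ T σ < 1 ∧ level p (σ, T σ) = 1

lemma IsBranch.pos {p : ℝ} {T : ℝ → ℝ} (hT : IsBranch p T) (hp : 1 < p) {σ : ℝ} (h1 : 1 ≤ σ)
    (h2 : σ < sigmaP p) : 0 < T σ := by
  obtain ⟨h0, -, hl⟩ := hT σ ⟨h1, h2.le⟩
  refine h0.lt_of_ne fun h => level_zero_ne_one hp h1 h2 ?_
  rw [← h] at hl
  exact hl

lemma IsBranch.hasDerivWithinAt {p : ℝ} {T : ℝ → ℝ} (hT : IsBranch p T) (hp : 1 < p) {σ : ℝ}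
    (h1 : 1 ≤ σ) (h2 : σ < sigmaP p) :
    HasDerivWithinAt T
      (-(unitScale p σ ^ (p + 1) *
          (Bcoef p σ (T σ) ^ (p - 1) + σ ^ (p - 1) * Acoef p σ (T σ) ^ (p - 1))) /
        (unitScale p (T σ) ^ (p + 1) *
          (Bcoef p σ (T σ) ^ (p - 1) - T σ ^ (p - 1) * Acoef p σ (T σ) ^ (p - 1))))
      (Icc 1 (sigmaP p)) σ := by
  have hp0 : 0 < p := by linarith
  have hσ : σ ∈ Icc 1 (sigmaP p) := ⟨h1, h2.le⟩
  have hτ := hT.pos hp h1 h2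
  obtain ⟨-, hτ1, hl⟩ := hT σ hσ
  have hQ := level_factor_pos hp hσ hτ hτ1
  have ht := Real.rpow_pos_of_pos (unitScale_pos (p := p) hτ.le) (p + 1)
  obtain ⟨φ, hφ, hφy, hφF⟩ := exists_implicit_hasDerivAt
    (hasStrictFDerivAt_level hp (by linarith : 0 ≤ σ) hτ.le)
    (mul_pos (mul_pos hp0 ht) hQ).ne'
  have hmem : ∀ᶠ z in 𝓝 σ, φ z ∈ Ioo 0 1 :=
    hφ.continuousAt.eventually_mem (by rw [hφy]; exact Ioo_mem_nhds hτ hτ1)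
  have heq : T =ᶠ[𝓝[Icc 1 (sigmaP p)] σ] φ := by
    filter_upwards [nhdsWithin_le_nhds hmem, nhdsWithin_le_nhds hφF, self_mem_nhdsWithin]
      with z hz hzF hzS
    obtain ⟨a, b, c⟩ := hT z hzS
    exact (level_strictMonoOn hp hzS).injOn ⟨a, b⟩ ⟨hz.1.le, hz.2⟩ (by simp [c, hzF, hl])
  refine (hφ.hasDerivWithinAt.congr_of_eventuallyEq heq hφy.symm).congr_deriv ?_
  field_simp

/-- The function `g` with the derivative of `Δ` eliminated. -/
noncomputable def gExplicit (p : ℝ) (T : ℝ → ℝ) (x : ℝ) : ℝ :=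
  unitScale p x * (1 - x * T x ^ (p - 1)) *
      (Bcoef p x (T x) ^ (p - 1) + x ^ (p - 1) * Acoef p x (T x) ^ (p - 1)) -
    unitScale p (T x) * (1 - T x * x ^ (p - 1)) *
      (Bcoef p x (T x) ^ (p - 1) - T x ^ (p - 1) * Acoef p x (T x) ^ (p - 1))

lemma IsBranch.exists_hasDerivWithinAt {p : ℝ} {T : ℝ → ℝ} (hT : IsBranch p T) (hp : 1 < p)
    {σ : ℝ} (h1 : 1 ≤ σ) (h2 : σ < sigmaP p) :
    ∃ D, HasDerivWithinAt T (-D) (Icc 1 (sigmaP p)) σ ∧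
      unitScale p (T σ) ^ (p + 1) * D *
          (Bcoef p σ (T σ) ^ (p - 1) - T σ ^ (p - 1) * Acoef p σ (T σ) ^ (p - 1)) =
        unitScale p σ ^ (p + 1) *
          (Bcoef p σ (T σ) ^ (p - 1) + σ ^ (p - 1) * Acoef p σ (T σ) ^ (p - 1)) := by
  have hτ := hT.pos hp h1 h2
  have hQ := level_factor_pos hp ⟨h1, h2.le⟩ hτ (hT σ ⟨h1, h2.le⟩).2.1
  have ht := Real.rpow_pos_of_pos (unitScale_pos (p := p) hτ.le) (p + 1)
  refine ⟨_, (hT.hasDerivWithinAt hp h1 h2).congr_deriv (neg_div _ _), ?_⟩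
  rw [mul_right_comm, mul_div_cancel₀ _ (mul_pos ht hQ).ne']

lemma uniqueDiffWithinAt_Icc_sigmaP {p σ : ℝ} (h1 : 1 ≤ σ) (h2 : σ < sigmaP p) :
    UniqueDiffWithinAt ℝ (Icc 1 (sigmaP p)) σ :=
  uniqueDiffOn_Icc (h1.trans_lt h2) σ ⟨h1, h2.le⟩

lemma IsBranch.gFun_eq {p : ℝ} {T : ℝ → ℝ} (hT : IsBranch p T) (hp : 1 < p) {σ : ℝ}
    (h1 : 1 ≤ σ) (h2 : σ < sigmaP p) : gFun p T σ = gExplicit p T σ := by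
  have hp0 : 0 < p := by linarith
  have hσ0 : 0 ≤ σ := by linarith
  have hτ := hT.pos hp h1 h2
  obtain ⟨D, hD, hDeq⟩ := hT.exists_hasDerivWithinAt hp h1 h2
  have hs := (hasStrictDerivAt_unitScale hp hσ0).hasDerivAt.hasDerivWithinAt
    (s := Icc 1 (sigmaP p))
  have ht := (hasStrictDerivAt_unitScale hp hτ.le).hasDerivAt.comp_hasDerivWithinAt σ hD
  have hΔ := ((hD.add (hasDerivWithinAt_id σ _)).mul ht).mul hs
  have eΔ : DeltaFun p T = (T + id) * (unitScale p ∘ T) * unitScale p := rfl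
  have hW : (1 + σ ^ p) ^ (1 + 1 / p) * unitScale p σ ^ (p + 1) = 1 := by
    rw [unitScale, ← Real.rpow_mul (one_add_rpow_pos hσ0).le,
      ← Real.rpow_add (one_add_rpow_pos hσ0)]
    convert Real.rpow_zero _ using 2
    field_simp
    ring
  have es := unitScale_rpow_add_one hp0 hσ0
  have et := unitScale_rpow_add_one hp0 hτ.le
  rw [← rpow_sub_one_mul hp hσ0] at es
  rw [← rpow_sub_one_mul hp hτ.le] at et
  rw [gFun, eΔ, hΔ.derivWithin (uniqueDiffWithinAt_Icc_sigmaP h1 h2), gExplicit]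
  simp only [Function.comp_apply, Pi.add_apply, Pi.mul_apply, id]
  generalize (1 + σ ^ p) ^ (1 + 1 / p) = W at *
  generalize unitScale p σ ^ (p + 1) = w at *
  generalize unitScale p (T σ) ^ (p + 1) = v at *
  generalize unitScale p σ = s at *
  generalize unitScale p (T σ) = t at *
  generalize σ ^ (p - 1) = u at *
  generalize T σ ^ (p - 1) = ε at *
  generalize Bcoef p σ (T σ) ^ (p - 1) = β at *
  generalize Acoef p σ (T σ) ^ (p - 1) = E at *
  generalize T σ = τ at *
  subst es et
  linear_combination (W * w * (1 + u * σ) * (1 - σ * ε)) * hDeq +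
    (w * (1 + u * σ) * (1 - σ * ε) * (β + u * E) -
      v * (1 + ε * τ) * (1 - τ * u) * (β - ε * E)) * hW

lemma hasDerivWithinAt_gExplicit {p : ℝ} {T : ℝ → ℝ} (hp : 2 ≤ p)
    {σ D : ℝ} {S : Set ℝ} (hσ : 0 ≤ σ) (hτ : 0 ≤ T σ) (hD : HasDerivWithinAt T (-D) S σ)
    {s t u ε A B A' B' w v : ℝ} (es : s = unitScale p σ) (et : t = unitScale p (T σ))
    (eu : u = σ ^ (p - 1)) (eε : ε = T σ ^ (p - 1)) (eA : A = Acoef p σ (T σ))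
    (eB : B = Bcoef p σ (T σ)) (ew : w = s ^ (p + 1)) (ev : v = t ^ (p + 1))
    (eA' : A' = ε * v * D + u * w) (eB' : B' = w - v * D) :
    HasDerivWithinAt (gExplicit p T)
      (-(u * w) * (1 - σ * ε) * (B ^ (p - 1) + u * A ^ (p - 1))
        + s * -(ε + σ * -((p - 1) * T σ ^ (p - 2) * D)) * (B ^ (p - 1) + u * A ^ (p - 1))
        + s * (1 - σ * ε) * ((p - 1) * B ^ (p - 2) * B' +
            ((p - 1) * σ ^ (p - 2) * A ^ (p - 1) + u * ((p - 1) * A ^ (p - 2) * A')))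
        - ε * v * D * (1 - T σ * u) * (B ^ (p - 1) - ε * A ^ (p - 1))
        + t * (-D * u + T σ * ((p - 1) * σ ^ (p - 2))) * (B ^ (p - 1) - ε * A ^ (p - 1))
        - t * (1 - T σ * u) * ((p - 1) * B ^ (p - 2) * B' -
            (-((p - 1) * T σ ^ (p - 2) * D) * A ^ (p - 1) + ε * ((p - 1) * A ^ (p - 2) * A'))))
      S σ := by
  have hp1 : 1 < p := by linarith
  have hq : 1 ≤ p - 1 := by linarith
  have hpq : p - 1 - 1 = p - 2 := by ring
  have dx := hasDerivWithinAt_id σ S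
  have ds := (hasStrictDerivAt_unitScale hp1 hσ).hasDerivAt.hasDerivWithinAt (s := S)
  have dt := (hasStrictDerivAt_unitScale hp1 hτ).hasDerivAt.comp_hasDerivWithinAt σ hD
  have dk := (hasStrictDerivAt_mul_unitScale hp1 hσ).hasDerivAt.hasDerivWithinAt (s := S)
  have dl := (hasStrictDerivAt_mul_unitScale hp1 hτ).hasDerivAt.comp_hasDerivWithinAt σ hD
  have dA : HasDerivWithinAt (fun x => Acoef p x (T x)) A' S σ :=
    (dt.sub ds).congr_deriv (by rw [eA', ew, ev, es, et, eu, eε]; ring)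
  have dB : HasDerivWithinAt (fun x => Bcoef p x (T x)) B' S σ :=
    (dk.add dl).congr_deriv (by rw [eB', ew, ev, es, et]; ring)
  have du := dx.rpow_const (p := p - 1) (Or.inr hq)
  have dε := hD.rpow_const (p := p - 1) (Or.inr hq)
  have dE := dA.rpow_const (p := p - 1) (Or.inr hq)
  have dβ := dB.rpow_const (p := p - 1) (Or.inr hq)
  have h := ((ds.mul ((dx.mul dε).const_sub 1)).mul (dβ.add (du.mul dE))).sub
    ((dt.mul ((hD.mul du).const_sub 1)).mul (dβ.sub (dε.mul dE)))
  refine h.congr_deriv ?_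
  simp only [Function.comp_apply, Pi.add_apply, Pi.mul_apply, Pi.sub_apply, id, hpq,
    ← eA, ← eB, ← eu, ← eε, ← es, ← et, ← ew, ← ev]
  ring

lemma mul_le_mul_of_nonneg_factors {a b c d : ℝ} (hab : a ≤ b) (hcd : c ≤ d) (ha : 0 ≤ a)
    (hc : 0 ≤ c) : a * c ≤ b * d :=
  mul_le_mul hab hcd hc (ha.trans hab)

/-- The numerical estimate: the derivative of `gExplicit` is negative when all the high powers
`ε = τ^{p-1}`, `E = A^{p-1}`, `a = (p-1)A^{p-2}`, `e = (p-1)τ^{p-2}` are small. -/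
lemma derivative_estimate {σ τ s t u ε E β w v D a b c e A' B' : ℝ}
    (hσ : 1 ≤ σ) (hσ' : σ ≤ 1.04) (hτ : 0 ≤ τ) (hτ' : τ ≤ 0.12)
    (hs : 0 ≤ s) (hs' : s ≤ 1) (ht : 0 ≤ t) (ht' : t ≤ 1) (hu : 1 ≤ u) (hu' : u ≤ 1.23)
    (hε : 0 ≤ ε) (hε' : ε ≤ 0.0001) (hE : 0 ≤ E) (hE' : E ≤ 0.0001)
    (hβ : 0.999 ≤ β) (hβ' : β ≤ 1) (hw : 0.39 ≤ w) (hw' : w ≤ 0.5) (hwv : w ≤ v) (hvt : v ≤ t)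
    (ha : 0 ≤ a) (ha' : a ≤ 0.002) (he : 0 ≤ e) (he' : e ≤ 0.002) (hb : 0 ≤ b) (hbE : b * E ≤ a)
    (hcE : c * E ≤ 1.23 * a) (hτc : τ * c ≤ 0.7 * u)
    (hD : v * D * (β - ε * E) = w * (β + u * E))
    (eA' : A' = ε * v * D + u * w) (eB' : B' = w - v * D) :
    -(u * w) * (1 - σ * ε) * (β + u * E)
        + s * -(ε + σ * -(e * D)) * (β + u * E)
        + s * (1 - σ * ε) * (b * B' + (c * E + u * (a * A')))
        - ε * v * D * (1 - τ * u) * (β - ε * E)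
        + t * (-D * u + τ * c) * (β - ε * E)
        - t * (1 - τ * u) * (b * B' - (-(e * D) * E + ε * (a * A'))) < 0 := by
  have huE : u * E ≤ 0.000123 :=
    (mul_le_mul_of_nonneg_factors hu' hE' (by linarith) hE).trans (by norm_num)
  have huE0 : 0 ≤ u * E := by positivity
  have hεE : ε * E ≤ 0.00000001 :=
    (mul_le_mul_of_nonneg_factors hε' hE' hε hE).trans (by norm_num)
  have hεE0 : 0 ≤ ε * E := by positivity
  have hQA : A' * (β - ε * E) = w * β * (u + ε) := by
    rw [eA']; linear_combination ε * hD
  have hQB : -B' * (β - ε * E) = w * (u + ε) * E := by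
    rw [eB']; linear_combination hD
  set P := β + u * E with hP
  set Q := β - ε * E with hQ
  have hP1 : 0.999 ≤ P := by linarith
  have hP2 : P ≤ 1.001 := by linarith
  have hQ1 : 0.998 ≤ Q := by linarith
  have hQ2 : Q ≤ P := by linarith
  have hQ0 : 0 < Q := by linarith
  have hP0 : 0 < P := by linarith
  have hw0 : 0 < w := by linarith
  have hv0 : 0 < v := by linarith
  have hu0 : 0 < u := by linarith
  have hD0 : 0 ≤ D := by
    have : 0 < v * D * Q := by rw [hD]; positivity
    have : 0 < v * D := pos_of_mul_pos_left this hQ0.le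
    exact (pos_of_mul_pos_right this hv0.le).le
  have hDQ : D * Q ≤ P := by
    have h1 : w * (D * Q) ≤ w * P := by
      rw [← hD, mul_assoc v]
      exact mul_le_mul_of_nonneg_right hwv (mul_nonneg hD0 hQ0.le)
    exact le_of_mul_le_mul_left h1 hw0
  have hD1 : D ≤ 1.01 := by
    have : D * 0.998 ≤ D * Q := mul_le_mul_of_nonneg_left hQ1 hD0
    linarith
  have huw : w * (u + ε) ≤ 0.7 :=
    (mul_le_mul_of_nonneg_factors hw' (by linarith : u + ε ≤ 1.24) (by linarith)
      (by linarith)).trans (by norm_num)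
  have huw0 : 0 ≤ w * (u + ε) := by positivity
  have hA0 : 0 ≤ A' := by rw [eA']; positivity
  have hA1 : A' ≤ 1 := by
    have h1 : A' * 0.998 ≤ A' * Q := mul_le_mul_of_nonneg_left hQ1 hA0
    have h2 : w * (u + ε) * β ≤ 0.7 * 1 := mul_le_mul_of_nonneg_factors huw hβ' huw0 (by linarith)
    linarith
  have hB0 : 0 ≤ -B' := by
    have : 0 ≤ -B' * Q := by rw [hQB]; positivity
    exact nonneg_of_mul_nonneg_left this hQ0
  have hB1 : -B' ≤ E := by
    have h1 : -B' * 0.998 ≤ -B' * Q := mul_le_mul_of_nonneg_left hQ1 hB0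
    have h2 : w * (u + ε) * E ≤ 0.7 * E := mul_le_mul_of_nonneg_right huw hE
    linarith
  have hσε : σ * ε ≤ 0.000104 :=
    (mul_le_mul_of_nonneg_factors hσ' hε' (by linarith) hε).trans (by norm_num)
  have hσε0 : 0 ≤ σ * ε := by positivity
  have hτu : τ * u ≤ 0.15 :=
    (mul_le_mul_of_nonneg_factors hτ' hu' hτ (by linarith)).trans (by norm_num)
  have hτu0 : 0 ≤ τ * u := by positivity
  have huwP : u * w * P ≤ 0.7 :=
    (mul_le_mul_of_nonneg_factors (mul_le_mul_of_nonneg_factors hu' hw' hu0.le hw0.le) hP2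
      (by positivity) hP0.le).trans
      (by norm_num)
  have X1 : -(u * w) * (1 - σ * ε) * P ≤ -(u * w * P) + 0.0001 := by
    have h1 : u * w * P * (σ * ε) ≤ 0.7 * 0.000104 :=
      mul_le_mul_of_nonneg_factors huwP hσε (by positivity) hσε0
    linarith
  have X2 : s * -(ε + σ * -(e * D)) * P ≤ 0.003 := by
    have h1 : e * D ≤ 0.00202 :=
      (mul_le_mul_of_nonneg_factors he' hD1 he hD0).trans (by norm_num)
    have h10 : 0 ≤ e * D := by positivity
    have h2 : σ * (e * D) ≤ 0.0022 :=
      (mul_le_mul_of_nonneg_factors hσ' h1 (by linarith) h10).trans (by norm_num)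
    have h20 : 0 ≤ σ * (e * D) := by positivity
    have h3 : s * (σ * (e * D)) * P ≤ 1 * 0.0022 * 1.001 :=
      mul_le_mul_of_nonneg_factors (mul_le_mul_of_nonneg_factors hs' h2 hs h20) hP2 (by positivity) hP0.le
    have h4 : 0 ≤ s * ε * P := by positivity
    linarith
  have haA : a * A' ≤ a :=
    mul_le_of_le_one_right ha hA1
  have haA0 : 0 ≤ a * A' := by positivity
  have hbB : b * -B' ≤ a := (mul_le_mul_of_nonneg_left hB1 hb).trans hbE
  have hbB0 : 0 ≤ b * -B' := mul_nonneg hb hB0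
  have X3 : s * (1 - σ * ε) * (b * B' + (c * E + u * (a * A'))) ≤ 0.005 := by
    have h0 : u * (a * A') ≤ 1.23 * 0.002 := mul_le_mul_of_nonneg_factors hu' (haA.trans ha') hu0.le haA0
    have h1 : b * B' + (c * E + u * (a * A')) ≤ 0.005 := by linarith
    have h2 : 0 ≤ s * (1 - σ * ε) := mul_nonneg hs (by linarith)
    have h3 : s * (1 - σ * ε) ≤ 1 :=
      mul_le_one₀ hs' (by linarith) (by linarith)
    calc s * (1 - σ * ε) * (b * B' + (c * E + u * (a * A')))
        ≤ s * (1 - σ * ε) * 0.005 := mul_le_mul_of_nonneg_left h1 h2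
      _ ≤ 0.005 := by linarith
  have X4 : 0 ≤ ε * v * D * (1 - τ * u) * Q := by
    have : 0 ≤ 1 - τ * u := by linarith
    positivity
  have X5 : t * (-D * u + τ * c) * Q ≤ -(u * w * P) + 0.7 * (u * P) := by
    have h1 : v * D * Q * u ≤ t * D * Q * u := by gcongr
    rw [hD] at h1
    have h2 : t * (τ * c) * Q ≤ 0.7 * (u * P) :=
      calc t * (τ * c) * Q ≤ t * (0.7 * u) * Q := by gcongr
        _ ≤ 1 * (0.7 * u) * P := by gcongr
        _ = _ := by ring
    linarith
  have X6 : -0.0025 ≤ t * (1 - τ * u) * (b * B' - (-(e * D) * E + ε * (a * A'))) := by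
    have h1 : 0 ≤ t * (1 - τ * u) := mul_nonneg ht (by linarith)
    have h2 : t * (1 - τ * u) ≤ 1 :=
      mul_le_one₀ ht' (by linarith) (by linarith)
    have h3 : 0 ≤ e * D * E := by positivity
    have h4 : ε * (a * A') ≤ 0.0001 :=
      (mul_le_mul_of_nonneg_factors hε' (haA.trans ha') hε haA0).trans (by norm_num)
    have h5 : -0.0025 ≤ b * B' - (-(e * D) * E + ε * (a * A')) := by linarith
    calc -0.0025 ≤ t * (1 - τ * u) * -0.0025 := by linarith
      _ ≤ _ := mul_le_mul_of_nonneg_left h5 h1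
  have hmain : 0.7 * (u * P) - 2 * (u * w * P) ≤ -0.07 := by
    have h1 : 0.999 ≤ u * P := hP1.trans (le_mul_of_one_le_left hP0.le hu)
    have h2 : u * P * 0.39 ≤ u * P * w := mul_le_mul_of_nonneg_left hw (by linarith)
    linarith
  linarith

lemma high_powers_small {p x : ℝ} (hp : 6 ≤ p) (hx : 0 ≤ x) (hpx : p * x ≤ 0.8) :
    (p - 1) * x ^ (p - 2) ≤ 0.002 ∧ x ^ (p - 1) ≤ 0.0001 := by
  have h1 : x ≤ 0.1334 := by nlinarith
  have h4 : x ^ (p - 2) ≤ x ^ (4 : ℕ) := by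
    rw [← Real.rpow_natCast]
    exact Real.rpow_le_rpow_of_exponent_ge' hx (by linarith) (by norm_num) (by norm_num; linarith)
  have h5 : x ^ (p - 1) ≤ x ^ (5 : ℕ) := by
    rw [← Real.rpow_natCast]
    exact Real.rpow_le_rpow_of_exponent_ge' hx (by linarith) (by norm_num) (by norm_num; linarith)
  have h3 : x ^ 3 ≤ 0.1334 ^ 3 := pow_le_pow_left₀ hx h1 3
  have h5' : x ^ 5 ≤ 0.1334 ^ 5 := pow_le_pow_left₀ hx h1 5
  constructor
  · calc (p - 1) * x ^ (p - 2) ≤ p * x ^ (4 : ℕ) := by gcongr; linarith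
      _ = (p * x) * x ^ 3 := by ring
      _ ≤ 0.8 * 0.1334 ^ 3 := by gcongr
      _ ≤ 0.002 := by norm_num
  · exact (h5.trans h5').trans (by norm_num)

lemma mul_le_of_two_mul_one_sub_rpow_ge {p τ : ℝ} (hp : 0 < p) (hτ : τ ≤ 1)
    (h : 1 ≤ 2 * (1 - τ) ^ p) : p * τ ≤ 0.7 := by
  have h1 : (1 - τ) ^ p ≤ Real.exp (-τ * p) := by
    rw [Real.exp_mul]
    exact Real.rpow_le_rpow (by linarith) (by linarith [Real.add_one_le_exp (-τ)]) hp.le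
  have h2 : Real.exp (τ * p) ≤ 2 := by
    have h3 : Real.exp (τ * p) * Real.exp (-τ * p) = 1 := by
      rw [← Real.exp_add]; simp
    nlinarith [Real.exp_pos (τ * p)]
  have h4 := (Real.le_log_iff_exp_le (by norm_num)).2 h2
  linarith [Real.log_two_lt_d9]

lemma exp_fifth_le : Real.exp (1 / 5) ≤ 1.2215 := by
  have h : Real.exp (1 / 5) ^ 5 = Real.exp 1 := by
    rw [← Real.exp_nat_mul]; norm_num
  refine le_of_pow_le_pow_left₀ (n := 5) (by norm_num) (by norm_num) ?_
  rw [h]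
  exact Real.exp_one_lt_d9.le.trans (by norm_num)

lemma log_le_four_fifths : Real.log 2.2215 ≤ 0.8 := by
  rw [Real.log_le_iff_le_exp (by norm_num)]
  have h : Real.exp 0.8 ^ 5 = Real.exp 1 ^ 4 := by
    rw [← Real.exp_nat_mul, ← Real.exp_nat_mul]; norm_num
  refine le_of_pow_le_pow_left₀ (n := 5) (by norm_num) (Real.exp_pos _).le ?_
  rw [h]
  calc (2.2215 : ℝ) ^ 5 ≤ 2.718 ^ 4 := by norm_num
    _ ≤ Real.exp 1 ^ 4 := by
      gcongr
      exact le_trans (by norm_num) Real.exp_one_gt_d9.le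

lemma rpow_le_of_le_one_add {p σ : ℝ} (hp : 0 < p) (hσ0 : 0 ≤ σ) (hσ : σ ≤ 1 + 1 / (5 * p)) :
    σ ^ p ≤ 1.2215 := by
  refine le_trans ?_ exp_fifth_le
  have h : Real.exp (1 / 5) = Real.exp (1 / (5 * p)) ^ p := by
    rw [← Real.exp_mul]; congr 1; field_simp
  rw [h]
  exact Real.rpow_le_rpow hσ0 (by linarith [Real.add_one_le_exp (1 / (5 * p))]) hp.le

lemma one_sub_le_unitScale {p σ : ℝ} (hp : 0 < p) (hσ : 0 ≤ σ) (h : σ ^ p ≤ 1.2215) :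
    1 - 0.8 / p ≤ unitScale p σ := by
  have h0 := one_add_rpow_pos (p := p) hσ
  have h1 : Real.log (1 + σ ^ p) ≤ 0.8 :=
    (Real.log_le_log h0 (by linarith)).trans log_le_four_fifths
  rw [unitScale, Real.rpow_def_of_pos h0]
  have h2 : Real.log (1 + σ ^ p) / p ≤ 0.8 / p := by gcongr
  have h3 : Real.log (1 + σ ^ p) * (-1 / p) = -(Real.log (1 + σ ^ p) / p) := by ring
  rw [h3]
  linarith [Real.add_one_le_exp (-(Real.log (1 + σ ^ p) / p))]

lemma unitScale_rpow_add_one_bounds {p σ : ℝ} (hp : 6 ≤ p) (h1 : 1 ≤ σ) (h : σ ^ p ≤ 1.2215) :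
    0.39 ≤ unitScale p σ ^ (p + 1) ∧ unitScale p σ ^ (p + 1) ≤ 0.5 := by
  have hp0 : 0 < p := by linarith
  have hσ0 : 0 ≤ σ := by linarith
  have hw := unitScale_rpow_add_one hp0 hσ0
  have hw0 := Real.rpow_pos_of_pos (unitScale_pos (p := p) hσ0) (p + 1)
  have hs1 := unitScale_le_one hp0 hσ0
  have hs2 := one_sub_le_unitScale hp0 hσ0 h
  have hp6 : 0.8 / p ≤ 0.8 / 6 := by gcongr
  have hy : 1 ≤ σ ^ p := Real.one_le_rpow h1 hp0.le
  constructor <;> nlinarith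

lemma lt_sigmaP {p σ : ℝ} (hp : 6 ≤ p) (hσ : 0 ≤ σ) (h : σ ^ p ≤ 1.2215) : σ < sigmaP p := by
  rw [← Real.rpow_lt_rpow_iff hσ (sigmaP_nonneg (by linarith)) (by linarith : 0 < p),
    sigmaP_rpow (by linarith)]
  have := Real.rpow_le_rpow_of_exponent_le (by norm_num : (1 : ℝ) ≤ 2) hp
  norm_num at this
  linarith

lemma IsBranch.hasDerivWithinAt_gExplicit_neg {p : ℝ} {T : ℝ → ℝ} (hT : IsBranch p T)
    (hp : 6 ≤ p) {σ : ℝ} (h1 : 1 ≤ σ) (h2 : σ ≤ 1 + 1 / (5 * p)) (hpτ : p * T σ ≤ 0.7) :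
    ∃ d < 0, HasDerivWithinAt (gExplicit p T) d (Icc 1 (sigmaP p)) σ := by
  have hp0 : 0 < p := by linarith
  have hp1 : 1 < p := by linarith
  have hσ0 : 0 < σ := by linarith
  have hy := rpow_le_of_le_one_add hp0 hσ0.le h2
  have hlt := lt_sigmaP hp hσ0.le hy
  have hτ := hT.pos hp1 h1 hlt
  obtain ⟨-, hτ1, hl⟩ := hT σ ⟨h1, hlt.le⟩
  have hτσ : T σ ≤ σ := by linarith
  obtain ⟨D, hD, hDeq⟩ := hT.exists_hasDerivWithinAt hp1 h1 hlt
  refine ⟨_, ?_, hasDerivWithinAt_gExplicit (by linarith) hσ0.le hτ.le hD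
    rfl rfl rfl rfl rfl rfl rfl rfl rfl rfl⟩
  have hs := unitScale_pos (p := p) hσ0.le
  have ht := unitScale_pos (p := p) hτ.le
  have hs1 := unitScale_le_one hp0 hσ0.le
  have ht1 := unitScale_le_one hp0 hτ.le
  have hst := unitScale_antitone hp0 hτ.le hτσ
  have hslow := one_sub_le_unitScale hp0 hσ0.le hy
  have hA0 := Acoef_nonneg hp0 hτ.le hτσ
  have hB0 : 0 ≤ Bcoef p σ (T σ) := hA0.trans (Acoef_lt_Bcoef hp1.le ⟨h1, hlt.le⟩ hτ).le
  have hA1 : Acoef p σ (T σ) ≤ 0.8 / p := by rw [Acoef_eq]; linarith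
  have hpA : p * Acoef p σ (T σ) ≤ 0.8 := by
    rw [le_div_iff₀ hp0] at hA1; linarith
  have hA1' : Acoef p σ (T σ) ≤ 1 := by rw [Acoef_eq]; linarith
  have hBp : Bcoef p σ (T σ) ^ p = 1 - Acoef p σ (T σ) ^ p := by
    have : Acoef p σ (T σ) ^ p + Bcoef p σ (T σ) ^ p = 1 := hl
    linarith
  have hAp0 := Real.rpow_nonneg hA0 p
  have hB1 : Bcoef p σ (T σ) ≤ 1 := by
    rw [← Real.rpow_le_rpow_iff hB0 zero_le_one hp0, Real.one_rpow]
    linarith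
  obtain ⟨ha, hE⟩ := high_powers_small hp hA0 hpA
  obtain ⟨he, hε⟩ := high_powers_small hp hτ.le (by linarith)
  have hAp : Acoef p σ (T σ) ^ p ≤ Acoef p σ (T σ) ^ (p - 1) :=
    Real.rpow_le_rpow_of_exponent_ge' hA0 hA1' (by linarith) (by linarith)
  have hEA : Acoef p σ (T σ) ^ (p - 1) ≤ Acoef p σ (T σ) ^ (p - 2) :=
    Real.rpow_le_rpow_of_exponent_ge' hA0 hA1' (by linarith) (by linarith)
  have hβ : Bcoef p σ (T σ) ^ p ≤ Bcoef p σ (T σ) ^ (p - 1) :=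
    Real.rpow_le_rpow_of_exponent_ge' hB0 hB1 (by linarith) (by linarith)
  have hu : σ ^ (p - 1) ≤ σ ^ p := Real.rpow_le_rpow_of_exponent_le h1 (by linarith)
  have hc : σ ^ (p - 2) ≤ σ ^ (p - 1) := Real.rpow_le_rpow_of_exponent_le h1 (by linarith)
  obtain ⟨hw, hw'⟩ := unitScale_rpow_add_one_bounds hp h1 hy
  have hp6 : 1 / (5 * p) ≤ 1 / 30 := by
    apply one_div_le_one_div_of_le <;> linarith
  have hτ2 : T σ ≤ 0.12 := by
    have := mul_le_mul_of_nonneg_right hp hτ.le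
    linarith
  have hA2 := Real.rpow_nonneg hA0 (p - 2)
  have hq : 0 ≤ p - 1 := by linarith
  refine derivative_estimate h1 (by linarith) hτ.le hτ2 hs.le hs1 ht.le ht1
    (Real.one_le_rpow h1 hq) (by linarith) (Real.rpow_nonneg hτ.le _) hε
    (Real.rpow_nonneg hA0 _) hE (by linarith) (Real.rpow_le_one hB0 hB1 hq) hw hw'
    (Real.rpow_le_rpow hs.le hst (by linarith)) ?_
    (mul_nonneg hq hA2) ha
    (mul_nonneg hq (Real.rpow_nonneg hτ.le _)) he (mul_nonneg hq (Real.rpow_nonneg hB0 _))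
    ?_ ?_ ?_ hDeq rfl rfl
  · calc unitScale p (T σ) ^ (p + 1) ≤ unitScale p (T σ) ^ (1 : ℝ) :=
          Real.rpow_le_rpow_of_exponent_ge ht ht1 (by linarith)
      _ = _ := Real.rpow_one _
  · calc (p - 1) * Bcoef p σ (T σ) ^ (p - 2) * Acoef p σ (T σ) ^ (p - 1)
        ≤ (p - 1) * 1 * Acoef p σ (T σ) ^ (p - 2) := by
          gcongr
          exact Real.rpow_le_one hB0 hB1 (by linarith)
      _ = _ := by ring
  · calc (p - 1) * σ ^ (p - 2) * Acoef p σ (T σ) ^ (p - 1)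
        ≤ (p - 1) * 1.23 * Acoef p σ (T σ) ^ (p - 2) := by
          gcongr
          linarith
      _ = _ := by ring
  · calc T σ * ((p - 1) * σ ^ (p - 2)) ≤ T σ * (p * σ ^ (p - 1)) := by
          gcongr
          linarith
      _ = p * T σ * σ ^ (p - 1) := by ring
      _ ≤ 0.7 * σ ^ (p - 1) := by gcongr

/-- For every real `p ≥ 6` and every `σ ∈ [1, 1 + 1/(5p)]`, one has
`h(p,σ) < 0`, where `h(p,σ) = ∂g(p,σ)/∂σ`. -/
theorem stmt_10 (p : ℝ) (hp : 6 ≤ p) (τp : ℝ)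
    (hτp : 0 ≤ τp ∧ τp < 1 ∧ 2 * (1 - τp) ^ p = 1 + τp ^ p)
    (T : ℝ → ℝ)
    (hT : ∀ σ ∈ Set.Icc 1 (sigmaP p),
      0 ≤ T σ ∧ T σ ≤ τp ∧ Acoef p σ (T σ) ^ p + Bcoef p σ (T σ) ^ p = 1)
    (σ : ℝ) (hσ : σ ∈ Set.Icc 1 (1 + 1 / (5 * p))) :
    derivWithin (gFun p T) (Set.Icc 1 (sigmaP p)) σ < 0 := by
  obtain ⟨hσ1, hσ2⟩ := hσ
  obtain ⟨hτp0, hτp1, hτpeq⟩ := hτp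
  have hp0 : 0 < p := by linarith
  have hσ0 : 0 ≤ σ := by linarith
  have hlt := lt_sigmaP hp hσ0 (rpow_le_of_le_one_add hp0 hσ0 hσ2)
  have hb : IsBranch p T := fun x hx =>
    ⟨(hT x hx).1, (hT x hx).2.1.trans_lt hτp1, (hT x hx).2.2⟩
  have hpτ : p * τp ≤ 0.7 :=
    mul_le_of_two_mul_one_sub_rpow_ge hp0 hτp1.le (by linarith [Real.rpow_nonneg hτp0 p])
  have hpT : p * T σ ≤ 0.7 :=
    (mul_le_mul_of_nonneg_left (hT σ ⟨hσ1, hlt.le⟩).2.1 hp0.le).trans hpτ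
  obtain ⟨d, hd, hderiv⟩ := hb.hasDerivWithinAt_gExplicit_neg hp hσ1 hσ2 hpT
  have heq : gFun p T =ᶠ[𝓝[Icc 1 (sigmaP p)] σ] gExplicit p T := by
    filter_upwards [self_mem_nhdsWithin, nhdsWithin_le_nhds (Iio_mem_nhds hlt)] with x hx hx'
    exact hb.gFun_eq (by linarith) hx.1 hx'
  rw [(hderiv.congr_of_eventuallyEq heq (hb.gFun_eq (by linarith) hσ1 hlt)).derivWithin
    (uniqueDiffWithinAt_Icc_sigmaP hσ1 hlt)]
  exact hd
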